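/- Homeomorphism of heaps over P is an equivalence relation: it is reflexive, symmetric, and transitive. -/

import Mathlib

/-- A heap over pointer variables `P`: a finite set `V` of vertices (drawn from `ℕ`),
a partial successor function `succ` (with `succ v = none` outside `V`),
an edge-weight function `wt` (weights are at least 1 on actual edges),
and a labelling `L` of pointer variables by vertices. -/
structure Heap (P : Type) where
  V : Finset ℕ
  succ : ℕ → Option ℕ
  wt : ℕ → ℕ
  L : P → ℕ
  label_mem : ∀ p, L p ∈ V
  succ_mem : ∀ v ∈ V, ∀ u, succ v = some u → u ∈ V
  succ_dom : ∀ v, v ∉ V → succ v = none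
  wt_pos : ∀ v ∈ V, succ v ≠ none → 1 ≤ wt v

namespace Heap

variable {P : Type}

/-- `vs` is a walk from `x` to `y`: a nonempty list of vertices starting at `x`,
ending at `y`, where each vertex's successor is the next list element. -/
def IsWalk (H : Heap P) (x y : ℕ) (vs : List ℕ) : Prop :=
  vs.head? = some x ∧ vs.getLast? = some y ∧
    List.Chain' (fun a b => H.succ a = some b) vs

/-- The weight of a walk: the sum of the weights of its edges,
i.e. of `wt vᵢ` over all but the last vertex. -/
def walkWeight (H : Heap P) (vs : List ℕ) : ℕ :=
  (vs.dropLast.map H.wt).sum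

/-- `pathLength H x y ∈ ℕ ∪ {∞}`: the least weight of a walk from `x` to `y`,
and `∞` if there is no walk. -/
noncomputable def pathLength (H : Heap P) (x y : ℕ) : ℕ∞ :=
  sInf {n : ℕ∞ | ∃ vs : List ℕ, H.IsWalk x y vs ∧ n = (H.walkWeight vs : ℕ∞)}

/-- `x` lies on a cycle: there is a walk from `x` to `x` with at least one step. -/
def Circular (H : Heap P) (x : ℕ) : Prop :=
  ∃ vs : List ℕ, H.IsWalk x x vs ∧ 2 ≤ vs.length

/-- A vertex is reachable if some labelled vertex reaches it by following successors. -/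
def Reachable (H : Heap P) (v : ℕ) : Prop :=
  ∃ p : P, Relation.ReflTransGen (fun a b => H.succ a = some b) (H.L p) v

/-- `H'` is obtained from `H` by a single-edge subdivision: the edge from `u`
(with `succ u = some v` and weight `n ≥ 2`) is split, for some `1 ≤ k < n`, by a
fresh vertex `q` into an edge `u → q` of weight `k` and an edge `q → v` of weight
`n - k`; everything else is unchanged. -/
def SingleSubdiv (H H' : Heap P) : Prop :=
  ∃ u v q k : ℕ,
    u ∈ H.V ∧ H.succ u = some v ∧ 2 ≤ H.wt u ∧ 1 ≤ k ∧ k < H.wt u ∧ q ∉ H.V ∧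
    H'.V = insert q H.V ∧
    H'.succ = Function.update (Function.update H.succ u (some q)) q (some v) ∧
    H'.wt = Function.update (Function.update H.wt u k) q (H.wt u - k) ∧
    H'.L = H.L

/-- `H'` is a subdivision of `H`: it is obtained from `H` by a finite (possibly
empty) sequence of single-edge subdivisions. -/
def Subdiv (H H' : Heap P) : Prop :=
  Relation.ReflTransGen SingleSubdiv H H'

/-- Heap isomorphism: a bijection between the reachable vertices that respects
labels, successors and weights. -/
def Iso (H H' : Heap P) : Prop :=
  ∃ f : ℕ → ℕ,
    Set.BijOn f {v | H.Reachable v} {v | H'.Reachable v} ∧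
    (∀ p, f (H.L p) = H'.L p) ∧
    (∀ v, H.Reachable v → H'.succ (f v) = Option.map f (H.succ v)) ∧
    (∀ v, H.Reachable v → H.succ v ≠ none → H'.wt (f v) = H.wt v)

/-- Heap homeomorphism: some subdivision of `H` is isomorphic to some
subdivision of `H'`. -/
def Homeo (H H' : Heap P) : Prop :=
  ∃ S S' : Heap P, H.Subdiv S ∧ H'.Subdiv S' ∧ Iso S S'

end Heap

namespace Heap

variable {P : Type}

/-- One unit step along the heap: the position `(v, i)` lies at distance `i` from `v` on the
edge leaving `v`. -/
def unitStep (H : Heap P) (x : ℕ × ℕ) : Option (ℕ × ℕ) :=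
  (H.succ x.1).map fun w => if x.2 + 1 < H.wt x.1 then (x.1, x.2 + 1) else (w, 0)

/-- The position reached from `H.L p` after `n` unit steps, if any. -/
def position (H : Heap P) (p : P) : ℕ → Option (ℕ × ℕ)
  | 0 => some (H.L p, 0)
  | n + 1 => (H.position p n).bind H.unitStep

/-- Two heaps are unit-step equivalent if walks by unit steps from the labelled vertices
terminate and meet at the same times in both. -/
def UnitStepEquiv (H H' : Heap P) : Prop :=
  (∀ p n, H.position p n = none ↔ H'.position p n = none) ∧
    ∀ p n p' n', H.position p n = H.position p' n' ↔ H'.position p n = H'.position p' n'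

theorem UnitStepEquiv.refl (H : Heap P) : UnitStepEquiv H H :=
  ⟨fun _ _ => Iff.rfl, fun _ _ _ _ => Iff.rfl⟩

theorem UnitStepEquiv.symm {H H' : Heap P} (h : UnitStepEquiv H H') : UnitStepEquiv H' H :=
  ⟨fun p n => (h.1 p n).symm, fun p n p' n' => (h.2 p n p' n').symm⟩

theorem UnitStepEquiv.trans {H H' H'' : Heap P} (h : UnitStepEquiv H H')
    (h' : UnitStepEquiv H' H'') : UnitStepEquiv H H'' :=
  ⟨fun p n => (h.1 p n).trans (h'.1 p n), fun p n p' n' => (h.2 p n p' n').trans (h'.2 p n p' n')⟩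

/-- A map of positions that is injective on a step-closed set and commutes with unit steps
gives a unit-step equivalence. -/
theorem UnitStepEquiv.of_injOn {H H' : Heap P} (D : Set (ℕ × ℕ)) (g : ℕ × ℕ → ℕ × ℕ)
    (hg : Set.InjOn g D) (hD : ∀ p, (H.L p, 0) ∈ D)
    (hDstep : ∀ x ∈ D, ∀ y, H.unitStep x = some y → y ∈ D)
    (hL : ∀ p, g (H.L p, 0) = (H'.L p, 0))
    (hstep : ∀ x ∈ D, H'.unitStep (g x) = (H.unitStep x).map g) : UnitStepEquiv H H' := by
  have mem : ∀ p n x, H.position p n = some x → x ∈ D := by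
    intro p n
    induction n with
    | zero => rintro x ⟨⟩; exact hD p
    | succ n ih =>
      intro x hx
      obtain ⟨y, hy, hyx⟩ := Option.bind_eq_some_iff.1 hx
      exact hDstep y (ih y hy) x hyx
  have map_eq : ∀ p n, H'.position p n = (H.position p n).map g := by
    intro p n
    induction n with
    | zero => simp [position, hL]
    | succ n ih =>
      simp only [position, ih]
      cases h : H.position p n with
      | none => rfl
      | some x => exact hstep x (mem p n x h)
  refine ⟨fun p n => by simp [map_eq], fun p n p' n' => ?_⟩
  rw [map_eq, map_eq]
  refine ⟨fun h => by rw [h], fun h => ?_⟩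
  cases hx : H.position p n with
  | none => simpa [hx, eq_comm] using h
  | some x =>
    cases hy : H.position p' n' with
    | none => simp [hx, hy] at h
    | some y =>
      simp only [hx, hy, Option.map_some, Option.some.injEq] at h
      rw [hg (mem _ _ _ hx) (mem _ _ _ hy) h]

theorem Reachable.succ {H : Heap P} {v w : ℕ} (h : H.Reachable v) (hw : H.succ v = some w) :
    H.Reachable w := by
  obtain ⟨p, hp⟩ := h
  exact ⟨p, hp.tail hw⟩

theorem Iso.unitStepEquiv {H H' : Heap P} (h : Iso H H') : UnitStepEquiv H H' := by
  obtain ⟨f, hf, hL, hs, hw⟩ := h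
  refine .of_injOn {x | H.Reachable x.1} (Prod.map f id) ?_ ?_ ?_ ?_ ?_
  · rintro ⟨a, i⟩ ha ⟨b, j⟩ hb hab
    simp only [Prod.map_apply, id_eq, Prod.mk.injEq] at hab
    exact Prod.ext (hf.injOn ha hb hab.1) hab.2
  · exact fun p => ⟨p, .refl⟩
  · rintro ⟨a, i⟩ ha y hy
    obtain ⟨w, hw, rfl⟩ := Option.map_eq_some_iff.1 hy
    have := Reachable.succ ha hw
    dsimp only
    split_ifs
    · exact ha
    · exact this
  · simp [hL]
  · rintro ⟨a, i⟩ ha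
    have hsa := hs a ha
    have hwa := hw a ha
    cases h : H.succ a with
    | none => simp [unitStep, hsa, h]
    | some w =>
      have := hwa (by simp [h])
      simp only [unitStep, Prod.map_apply, id_eq, hsa, h, Option.map_some, this]
      split_ifs <;> rfl

theorem SingleSubdiv.unitStepEquiv {H H' : Heap P} (h : SingleSubdiv H H') :
    UnitStepEquiv H H' := by
  obtain ⟨u, v, q, k, hu, huv, h2, hk, hkn, hq, hV, hs, hw, hL⟩ := h
  have hv := H.succ_mem u hu v huv
  have huq : u ≠ q := fun e => hq (e ▸ hu)
  refine .of_injOn {x | x.1 ∈ H.V} (fun x => if x.1 = u ∧ k ≤ x.2 then (q, x.2 - k) else x)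
    ?_ ?_ ?_ ?_ ?_
  · rintro ⟨a, i⟩ ha ⟨b, j⟩ hb hab
    simp only [Set.mem_ofPred_eq] at ha hb
    have haq : a ≠ q := fun e => hq (e ▸ ha)
    have hbq : b ≠ q := fun e => hq (e ▸ hb)
    dsimp only at hab
    split_ifs at hab <;> simp only [Prod.mk.injEq] at hab ⊢ <;> grind
  · exact H.label_mem
  · rintro ⟨a, i⟩ ha y hy
    obtain ⟨w, hw, rfl⟩ := Option.map_eq_some_iff.1 hy
    have := H.succ_mem a ha w hw
    dsimp only
    split_ifs
    · exact ha
    · exact this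
  · intro p
    simp [hL, Nat.ne_of_gt hk]
  · rintro ⟨a, i⟩ ha
    have haq : a ≠ q := fun e => hq (e ▸ ha)
    by_cases hau : a = u
    · subst hau
      by_cases hki : k ≤ i
      · simp [unitStep, hs, hw, hki, huv]
        grind
      · simp [unitStep, hs, hw, hki, huv, haq]
        grind
    · simp only [unitStep, hs, hw, hau, false_and, if_false, Function.update_of_ne haq,
        Function.update_of_ne hau, Option.map_map]
      congr 1
      funext w
      simp only [Function.comp]
      split_ifs <;> grind

theorem Subdiv.unitStepEquiv {H H' : Heap P} (h : Subdiv H H') : UnitStepEquiv H H' := by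
  induction h with
  | refl => exact .refl H
  | tail _ h ih => exact ih.trans h.unitStepEquiv

theorem Homeo.unitStepEquiv {H H' : Heap P} (h : Homeo H H') : UnitStepEquiv H H' := by
  obtain ⟨S, S', hS, hS', hi⟩ := h
  exact (hS.unitStepEquiv.trans hi.unitStepEquiv).trans hS'.unitStepEquiv.symm

/-- All edges have weight one. -/
def IsUnit (H : Heap P) : Prop :=
  ∀ v, H.succ v ≠ none → H.wt v = 1

/-- An edge of weight at least two can be split. -/
theorem exists_singleSubdiv (H : Heap P) {u v : ℕ} (huv : H.succ u = some v)
    (h2 : 2 ≤ H.wt u) : ∃ H', SingleSubdiv H H' ∧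
      ∑ x ∈ H'.V, (H'.wt x - 1) < ∑ x ∈ H.V, (H.wt x - 1) := by
  have hu : u ∈ H.V := by
    by_contra h
    simp [H.succ_dom u h] at huv
  have hv := H.succ_mem u hu v huv
  obtain ⟨q, hq⟩ := Infinite.exists_notMem_finset H.V
  have huq : u ≠ q := fun e => hq (e ▸ hu)
  let H' : Heap P :=
    { V := insert q H.V
      succ := Function.update (Function.update H.succ u (some q)) q (some v)
      wt := Function.update (Function.update H.wt u 1) q (H.wt u - 1)
      L := H.L
      label_mem := fun p => Finset.mem_insert_of_mem (H.label_mem p)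
      succ_mem := by
        intro a ha b hab
        have := H.succ_mem a
        simp only [Function.update_apply, Finset.mem_insert] at *
        grind
      succ_dom := by
        intro a ha
        have := H.succ_dom a
        simp only [Function.update_apply, Finset.mem_insert] at *
        grind
      wt_pos := by
        intro a ha hs
        have := H.wt_pos a
        simp only [Function.update_apply, Finset.mem_insert] at *
        grind }
  refine ⟨H', ⟨u, v, q, 1, hu, huv, h2, le_rfl, h2, hq, rfl, rfl, rfl, rfl⟩, ?_⟩
  have hrest : ∑ x ∈ H.V.erase u, (H'.wt x - 1) = ∑ x ∈ H.V.erase u, (H.wt x - 1) := by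
    refine Finset.sum_congr rfl fun x hx => ?_
    have hxq : x ≠ q := fun e => hq (e ▸ Finset.mem_of_mem_erase hx)
    simp [H', hxq, Finset.ne_of_mem_erase hx]
  change ∑ x ∈ insert q H.V, (H'.wt x - 1) < _
  rw [Finset.sum_insert hq, ← Finset.add_sum_erase _ _ hu, hrest, ← Finset.add_sum_erase _ _ hu]
  have hwq : H'.wt q = H.wt u - 1 := by simp [H']
  have hwu : H'.wt u = 1 := by simp [H', huq]
  omega

theorem exists_subdiv_isUnit (H : Heap P) : ∃ U, H.Subdiv U ∧ U.IsUnit := by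
  induction hm : ∑ x ∈ H.V, (H.wt x - 1) using Nat.strong_induction_on generalizing H with
  | _ m ih =>
    by_cases hH : H.IsUnit
    · exact ⟨H, .refl, hH⟩
    · simp only [IsUnit, not_forall] at hH
      obtain ⟨u, hu, hw⟩ := hH
      obtain ⟨v, huv⟩ := Option.ne_none_iff_exists'.1 hu
      have huV : u ∈ H.V := not_not.1 fun h => hu (H.succ_dom u h)
      have := H.wt_pos u huV hu
      obtain ⟨H', hs, hlt⟩ := H.exists_singleSubdiv huv (by omega)
      obtain ⟨U, hU, hunit⟩ := ih _ (hm ▸ hlt) H' rfl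
      exact ⟨U, .head hs hU, hunit⟩

theorem IsUnit.unitStep {H : Heap P} (hH : H.IsUnit) (v : ℕ) :
    H.unitStep (v, 0) = (H.succ v).map (·, 0) := by
  cases h : H.succ v with
  | none => simp [Heap.unitStep, h]
  | some w => simp [Heap.unitStep, h, hH v (by simp [h])]

theorem IsUnit.position_succ {H : Heap P} (hH : H.IsUnit) {p : P} {n v : ℕ}
    (h : H.position p n = some (v, 0)) : H.position p (n + 1) = (H.succ v).map (·, 0) := by
  simp [position, h, hH.unitStep]

theorem IsUnit.position_reachable {H : Heap P} (hH : H.IsUnit) {p : P} {n : ℕ} {x : ℕ × ℕ}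
    (hx : H.position p n = some x) : x.2 = 0 ∧ H.Reachable x.1 := by
  induction n generalizing x with
  | zero =>
    cases hx
    exact ⟨rfl, p, .refl⟩
  | succ n ih =>
    obtain ⟨⟨v, i⟩, hy, hyx⟩ := Option.bind_eq_some_iff.1 hx
    obtain ⟨hi, hr⟩ := ih hy
    obtain rfl : i = 0 := hi
    rw [hH.unitStep] at hyx
    obtain ⟨w, hw, rfl⟩ := Option.map_eq_some_iff.1 hyx
    exact ⟨rfl, hr.succ hw⟩

theorem IsUnit.reachable_iff {H : Heap P} (hH : H.IsUnit) {v : ℕ} :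
    H.Reachable v ↔ ∃ p n, H.position p n = some (v, 0) := by
  constructor
  · rintro ⟨p, hp⟩
    refine ⟨p, ?_⟩
    induction hp with
    | refl => exact ⟨0, rfl⟩
    | tail _ hs ih =>
      obtain ⟨n, hn⟩ := ih
      exact ⟨n + 1, by rw [hH.position_succ hn, hs]; rfl⟩
  · rintro ⟨p, n, h⟩
    exact (hH.position_reachable h).2

theorem IsUnit.exists_position_eq {H H' : Heap P} (hH' : H'.IsUnit) (h : UnitStepEquiv H H')
    {p : P} {n : ℕ} {x : ℕ × ℕ} (hx : H.position p n = some x) :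
    ∃ w, H'.position p n = some (w, 0) := by
  have hne : H'.position p n ≠ none := fun e => by simp [(h.1 p n).2 e] at hx
  obtain ⟨⟨w, i⟩, hw⟩ := Option.ne_none_iff_exists'.1 hne
  obtain rfl : i = 0 := (hH'.position_reachable hw).1
  exact ⟨w, hw⟩

theorem UnitStepEquiv.iso {H H' : Heap P} (h : UnitStepEquiv H H') (hH : H.IsUnit)
    (hH' : H'.IsUnit) : Iso H H' := by
  have hex : ∀ v, ∃ w, ∀ p n, H.position p n = some (v, 0) → H'.position p n = some (w, 0) := by
    intro v
    by_cases hv : ∃ p n, H.position p n = some (v, 0)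
    · obtain ⟨p, n, hpn⟩ := hv
      obtain ⟨w, hw⟩ := hH'.exists_position_eq h hpn
      exact ⟨w, fun p' n' h' => by rw [(h.2 p' n' p n).1 (h'.trans hpn.symm), hw]⟩
    · exact ⟨0, fun p n hpn => (hv ⟨p, n, hpn⟩).elim⟩
  choose f hf using hex
  have hsucc : ∀ v, H.Reachable v → H'.succ (f v) = Option.map f (H.succ v) := by
    intro v hv
    obtain ⟨p, n, hpn⟩ := hH.reachable_iff.1 hv
    have h1 := hH.position_succ hpn
    have h2 := hH'.position_succ (hf v p n hpn)
    cases hs : H.succ v with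
    | none =>
      rw [hs] at h1
      rw [(h.1 p (n + 1)).1 h1] at h2
      simpa [eq_comm] using h2
    | some w =>
      rw [hs] at h1
      rw [hf w p (n + 1) h1] at h2
      obtain ⟨w', hw', he⟩ := Option.map_eq_some_iff.1 h2.symm
      cases he
      exact hw'
  refine ⟨f, ⟨?_, ?_, ?_⟩, ?_, hsucc, ?_⟩
  · intro v hv
    obtain ⟨p, n, hpn⟩ := hH.reachable_iff.1 hv
    exact hH'.reachable_iff.2 ⟨p, n, hf v p n hpn⟩
  · intro v hv v' hv' he
    obtain ⟨p, n, hpn⟩ := hH.reachable_iff.1 hv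
    obtain ⟨p', n', hpn'⟩ := hH.reachable_iff.1 hv'
    have := (h.2 p n p' n').2 (by rw [hf v p n hpn, hf v' p' n' hpn', he])
    rw [hpn, hpn'] at this
    cases this
    rfl
  · intro w hw
    obtain ⟨p, n, hpn⟩ := hH'.reachable_iff.1 hw
    obtain ⟨v, hv⟩ := hH.exists_position_eq h.symm hpn
    refine ⟨v, hH.reachable_iff.2 ⟨p, n, hv⟩, ?_⟩
    have := hf v p n hv
    rw [hpn] at this
    cases this
    rfl
  · intro p
    have : some (H'.L p, 0) = some (f (H.L p), 0) := hf (H.L p) p 0 rfl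
    simpa [eq_comm] using this
  · intro v hv hs
    rw [hH v hs, hH' (f v) (by simpa [hsucc v hv] using hs)]

theorem homeo_iff_unitStepEquiv {H H' : Heap P} : Homeo H H' ↔ UnitStepEquiv H H' := by
  refine ⟨Homeo.unitStepEquiv, fun h => ?_⟩
  obtain ⟨U, hU, hunit⟩ := H.exists_subdiv_isUnit
  obtain ⟨U', hU', hunit'⟩ := H'.exists_subdiv_isUnit
  exact ⟨U, U', hU, hU',
    ((hU.unitStepEquiv.symm.trans h).trans hU'.unitStepEquiv).iso hunit hunit'⟩

end Heap

/-- Homeomorphism of heaps over `P` is an equivalence relation. -/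
theorem homeo_equivalence (P : Type) :
    Reflexive (Heap.Homeo (P := P)) ∧ Symmetric (Heap.Homeo (P := P)) ∧
      Transitive (Heap.Homeo (P := P)) := by
  refine ⟨fun H => ?_, fun H H' h => ?_, fun H H' H'' h h' => ?_⟩
  · exact Heap.homeo_iff_unitStepEquiv.2 (.refl H)
  · exact Heap.homeo_iff_unitStepEquiv.2 h.unitStepEquiv.symm
  · exact Heap.homeo_iff_unitStepEquiv.2 (h.unitStepEquiv.trans h'.unitStepEquiv)
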